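/- Let 0 < α < 1 and fix 0 < ε < 1/2. Then for every η > 0 there exist δ > 0 and c > 0 such that for all sufficiently large k the following holds: if n ≤ c · k^{1/α − η}, then for every estimator f : X^n → ℝ there exists a probability distribution p over an alphabet X of k elements with P_{X^n ~ p^{⊗n}}( |H_α(p) − f(X_1, …, X_n)| > δ ) ≥ ε. In other words, the sample complexity of estimating the order-α Rényi entropy grows polynomially in k with exponent at least 1/α − η for every η > 0 (S_α(k) = Ω̃~(k^{1/α})). -/

import Mathlib

open Real

/-- `p` is a probability distribution on a finite alphabet. -/
def IsDist {X : Type*} [Fintype X] (p : X → ℝ) : Prop :=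
  (∀ x, 0 ≤ p x) ∧ ∑ x, p x = 1

/-- The Rényi entropy of order `α ≠ 1`. -/
noncomputable def renyiEntropy {X : Type*} [Fintype X] (α : ℝ) (p : X → ℝ) : ℝ :=
  (1 / (1 - α)) * Real.log (∑ x, p x ^ α)

open Classical in
/-- The probability, under `n` i.i.d. samples from `p`, of the event `E` on sample sequences. -/
noncomputable def probEvent {X : Type*} [Fintype X] {n : ℕ} (p : X → ℝ)
    (E : (Fin n → X) → Prop) : ℝ :=
  ∑ s : Fin n → X, if E s then ∏ i, p (s i) else 0

open Filter Topology

/-- The vectors of `(ℤ/2)^M` whose coordinates sum to `c`. -/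
def parityClass (M : ℕ) (c : ZMod 2) : Finset (Fin M → ZMod 2) :=
  Finset.univ.filter fun U => ∑ i, U i = c

/-- The vectors of `(ℤ/2)^M` with even coordinate sum, as a type. -/
abbrev EvenVec (M : ℕ) : Type := {U : Fin M → ZMod 2 // ∑ i, U i = 0}

/-- The Hamming weight of a binary vector, shifted by `t`. -/
def shiftedWeight {M : ℕ} (t : ℝ) (U : Fin M → ZMod 2) : ℝ :=
  t + ∑ i, ((U i).val : ℝ)

lemma mem_parityClass {M : ℕ} {c : ZMod 2} {U : Fin M → ZMod 2} :
    U ∈ parityClass M c ↔ ∑ i, U i = c := by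
  simp [parityClass]

/-- A function invariant under flipping one coordinate has the same sum over both parity classes. -/
lemma sum_parityClass_eq_of_update {M : ℕ} (i : Fin M) (F : (Fin M → ZMod 2) → ℝ)
    (hF : ∀ U, F (U + Pi.single i 1) = F U) :
    ∑ U ∈ parityClass M 0, F U = ∑ U ∈ parityClass M 1, F U := by
  refine Finset.sum_equiv (Equiv.addRight (Pi.single i 1)) (fun U => ?_) fun U _ => ?_
  · simp [mem_parityClass, Finset.sum_add_distrib]
  · simp [hF]

/-- Products of fewer than `M` coordinatewise additive functions have the same sum over both
parity classes. -/
lemma sum_parityClass_prod_eq {M : ℕ} {J : Type*} [Fintype J] (hJ : Fintype.card J < M)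
    (h : J → Fin M → ZMod 2 → ℝ) :
    ∑ U ∈ parityClass M 0, ∏ j, ∑ i, h j i (U i) =
      ∑ U ∈ parityClass M 1, ∏ j, ∑ i, h j i (U i) := by
  classical
  simp only [Finset.prod_univ_sum]
  rw [Finset.sum_comm, Finset.sum_comm (s := parityClass M 1)]
  refine Finset.sum_congr rfl fun φ _ => ?_
  obtain ⟨i, hi⟩ : ∃ i, ∀ j, φ j ≠ i := by
    by_contra! hsurj
    have := Fintype.card_le_of_surjective φ hsurj
    simp at this
    omega
  refine sum_parityClass_eq_of_update i _ fun U => Finset.prod_congr rfl fun j _ => ?_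
  simp [hi j]

lemma card_parityClass_eq {M : ℕ} (hM : 0 < M) :
    (parityClass M 0).card = (parityClass M 1).card := by
  have := sum_parityClass_eq_of_update (⟨0, hM⟩ : Fin M) (fun _ => 1) (fun _ => rfl)
  simpa using this

lemma zero_mem_parityClass (M : ℕ) : (0 : Fin M → ZMod 2) ∈ parityClass M 0 := by
  simp [mem_parityClass]

lemma shiftedWeight_nonneg {M : ℕ} {t : ℝ} (ht : 0 ≤ t) (U : Fin M → ZMod 2) :
    0 ≤ shiftedWeight t U := by
  unfold shiftedWeight; positivity

lemma shiftedWeight_eq_sum {M : ℕ} (hM : 0 < M) (t : ℝ) (U : Fin M → ZMod 2) :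
    shiftedWeight t U = ∑ i, (t / M + ((U i).val : ℝ)) := by
  have : (M : ℝ) ≠ 0 := by positivity
  simp only [shiftedWeight, Finset.sum_add_distrib, Finset.sum_const, Finset.card_univ,
    Fintype.card_fin, nsmul_eq_mul]
  field_simp

lemma sum_shiftedWeight_eq {M : ℕ} (hM : 2 ≤ M) (t : ℝ) :
    ∑ U ∈ parityClass M 0, shiftedWeight t U = ∑ U ∈ parityClass M 1, shiftedWeight t U := by
  have := sum_parityClass_prod_eq (M := M) (J := Unit) (by simp; omega)
    (fun _ _ z => t / M + (z.val : ℝ))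
  simpa [shiftedWeight_eq_sum (by omega : 0 < M)] using this

/-- Translation by a vector of parity `c` carries the even vectors onto the parity class `c`. -/
lemma sum_evenVec_add {M : ℕ} {c : ZMod 2} {σ : Fin M → ZMod 2} (hσ : σ ∈ parityClass M c)
    (F : (Fin M → ZMod 2) → ℝ) :
    ∑ T : EvenVec M, F (σ + T) = ∑ U ∈ parityClass M c, F U := by
  rw [mem_parityClass] at hσ
  rw [← Finset.sum_subtype (parityClass M 0) (fun U => mem_parityClass) (fun U => F (σ + U))]
  refine Finset.sum_equiv (Equiv.addLeft σ) (fun U => ?_) fun U _ => rfl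
  simp [mem_parityClass, Finset.sum_add_distrib, hσ]

lemma abs_add_rpow_sub_rpow_le {α t : ℝ} (hα0 : 0 < α) (hα1 : α < 1) (ht : 0 ≤ t) {w : ℝ}
    (hw : 1 ≤ w) : |(t + w) ^ α - w ^ α| ≤ t := by
  have hw0 : 0 < w := by linarith
  have hle : w ^ α ≤ (t + w) ^ α := rpow_le_rpow hw0.le (by linarith) hα0.le
  rw [abs_of_nonneg (by linarith)]
  have htw : t + w = w * (1 + t / w) := by field_simp; ring
  have htw0 : 0 ≤ t / w := by positivity
  have hb : (1 + t / w) ^ α ≤ 1 + α * (t / w) :=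
    rpow_one_add_le_one_add_mul_self (by linarith) hα0.le hα1.le
  have hwα : w ^ α ≤ w := by
    simpa using rpow_le_rpow_of_exponent_le hw hα1.le
  rw [htw, mul_rpow hw0.le (by linarith)]
  have hwα0 : 0 < w ^ α := by positivity
  calc w ^ α * (1 + t / w) ^ α - w ^ α ≤ w ^ α * (1 + α * (t / w)) - w ^ α := by gcongr
    _ = w ^ α * (α * (t / w)) := by ring
    _ ≤ w * (1 * (t / w)) := by gcongr
    _ = t := by field_simp

/-- The `α`-power sums of the shifted weights separate the parity classes for some shift,
because `t ↦ t ^ α` is not Lipschitz at zero. -/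
lemma exists_sum_shiftedWeight_rpow_ne {α : ℝ} (hα0 : 0 < α) (hα1 : α < 1) (M : ℕ) :
    ∃ t : ℝ, 0 ≤ t ∧ ∑ U ∈ parityClass M 0, shiftedWeight t U ^ α ≠
      ∑ U ∈ parityClass M 1, shiftedWeight t U ^ α := by
  by_contra! hall
  set E := (parityClass M 0).erase 0
  set O := parityClass M 1
  have hsplit : ∀ t : ℝ, 0 ≤ t → t ^ α =
      ∑ U ∈ O, shiftedWeight t U ^ α - ∑ U ∈ E, shiftedWeight t U ^ α := by
    intro t ht
    rw [← hall t ht, ← Finset.add_sum_erase _ _ (zero_mem_parityClass M)]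
    simp [E, shiftedWeight]
  have hlip : ∀ (t : ℝ), 0 ≤ t → ∀ U : Fin M → ZMod 2, U ≠ 0 →
      |shiftedWeight t U ^ α - shiftedWeight 0 U ^ α| ≤ t := by
    intro t ht U hU
    obtain ⟨i, hi⟩ : ∃ i, U i ≠ 0 := by
      by_contra! h
      exact hU (funext h)
    have hone : (1 : ℝ) ≤ ∑ i, ((U i).val : ℝ) := by
      have h1 : (1 : ℝ) ≤ ((U i).val : ℝ) := by
        have : 0 < (U i).val := Nat.pos_of_ne_zero (by simpa using hi)
        exact_mod_cast this
      exact h1.trans (Finset.single_le_sum (f := fun i => ((U i).val : ℝ))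
        (fun _ _ => by positivity) (Finset.mem_univ i))
    simpa [shiftedWeight] using abs_add_rpow_sub_rpow_le hα0 hα1 ht hone
  set N : ℝ := (O.card : ℝ) + E.card
  have hN : 0 ≤ N := by positivity
  have hbound : ∀ t : ℝ, 0 ≤ t → t ^ α ≤ N * t := by
    intro t ht
    have h0 := hsplit 0 le_rfl
    rw [zero_rpow hα0.ne'] at h0
    have hO : ∑ U ∈ O, (shiftedWeight t U ^ α - shiftedWeight 0 U ^ α) ≤ O.card * t := by
      rw [← nsmul_eq_mul]
      refine Finset.sum_le_card_nsmul _ _ _ fun U hU => (le_abs_self _).trans (hlip t ht U ?_)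
      rintro rfl
      simp [O, mem_parityClass] at hU
    have hE : ∑ U ∈ E, (shiftedWeight 0 U ^ α - shiftedWeight t U ^ α) ≤ E.card * t := by
      rw [← nsmul_eq_mul]
      refine Finset.sum_le_card_nsmul _ _ _ fun U hU => (le_abs_self _).trans ?_
      rw [abs_sub_comm]
      exact hlip t ht U (Finset.ne_of_mem_erase hU)
    rw [Finset.sum_sub_distrib] at hO hE
    rw [hsplit t ht]
    simp only [N]
    linarith
  have h1α : 0 < 1 - α := by linarith
  set t : ℝ := (N + 1) ^ (-(1 / (1 - α)))
  have ht : 0 < t := by positivity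
  have hkey : t ^ α = (N + 1) * t := by
    have : t ^ (1 - α) = (N + 1)⁻¹ := by
      simp only [t]
      rw [← rpow_mul (by positivity), ← rpow_neg_one]
      congr 1
      field_simp
    have h2 : t ^ α * t ^ (1 - α) = t := by
      rw [← rpow_add ht]; simp
    rw [this] at h2
    field_simp at h2
    linarith
  have := hbound t ht.le
  nlinarith

lemma probEvent_mono {X : Type*} [Fintype X] {n : ℕ} {p : X → ℝ} (hp : ∀ x, 0 ≤ p x)
    {E F : (Fin n → X) → Prop} (h : ∀ s, E s → F s) : probEvent p E ≤ probEvent p F := by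
  classical
  refine Finset.sum_le_sum fun s _ => ?_
  have := Finset.prod_nonneg fun i (_ : i ∈ Finset.univ) => hp (s i)
  by_cases hE : E s
  · simp [hE, h s hE]
  · by_cases hF : F s <;> simp [hE, hF, this]

lemma sum_prod_eq_one {X : Type*} [Fintype X] {p : X → ℝ} (hp : IsDist p) (n : ℕ) :
    ∑ s : Fin n → X, ∏ i, p (s i) = 1 := by
  classical
  have := Finset.prod_univ_sum (fun _ : Fin n => (Finset.univ : Finset X)) (fun _ x => p x)
  rw [Fintype.piFinset_univ] at this
  rw [← this]
  simp [hp.2]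

/-- Le Cam's two-point method for two mixtures that agree outside an unlikely event. -/
lemma exists_probEvent_ge_of_mixtures {Y ι : Type*} [Fintype Y] {n : ℕ} {α ε δ H₀ H₁ : ℝ}
    {A₀ A₁ : Finset ι} (hcard : A₀.card = A₁.card) (hne : A₀.Nonempty) {p : ι → Y → ℝ}
    (hp₀ : ∀ S ∈ A₀, IsDist (p S)) (hp₁ : ∀ S ∈ A₁, IsDist (p S))
    (hH₀ : ∀ S ∈ A₀, renyiEntropy α (p S) = H₀) (hH₁ : ∀ S ∈ A₁, renyiEntropy α (p S) = H₁)
    (hH : 2 * δ < |H₀ - H₁|) (Z : (Fin n → Y) → Prop)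
    (hZ : ∀ s, Z s → ∑ S ∈ A₀, ∏ i, p S (s i) = ∑ S ∈ A₁, ∏ i, p S (s i))
    (htail : ∀ S ∈ A₀, probEvent (p S) (fun s => ¬ Z s) ≤ 1 - 2 * ε) (f : (Fin n → Y) → ℝ) :
    ∃ S, IsDist (p S) ∧ ε ≤ probEvent (p S) (fun s => δ < |renyiEntropy α (p S) - f s|) := by
  classical
  by_contra! hcon
  set F₀ : (Fin n → Y) → Prop := fun s => δ < |H₀ - f s|
  set F₁ : (Fin n → Y) → Prop := fun s => δ < |H₁ - f s|
  have hcover : ∀ s, F₀ s ∨ F₁ s := by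
    intro s
    by_contra! h
    simp only [F₀, F₁, not_lt] at h
    have := abs_sub_le H₀ (f s) H₁
    rw [abs_sub_comm (f s)] at this
    linarith [h.1, h.2]
  have h₀ : ∀ S ∈ A₀, probEvent (p S) F₀ < ε := fun S hS => by
    simpa [hH₀ S hS] using hcon S (hp₀ S hS)
  have h₁ : ∀ S ∈ A₁, probEvent (p S) F₁ < ε := fun S hS => by
    simpa [hH₁ S hS] using hcon S (hp₁ S hS)
  have hone : ∀ S ∈ A₀, (1 : ℝ) ≤ probEvent (p S) F₀ +
      probEvent (p S) (fun s => F₁ s ∧ Z s) + probEvent (p S) (fun s => ¬ Z s) := by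
    intro S hS
    rw [← sum_prod_eq_one (hp₀ S hS) n]
    simp only [probEvent, ← Finset.sum_add_distrib]
    refine Finset.sum_le_sum fun s _ => ?_
    have := Finset.prod_nonneg fun i (_ : i ∈ Finset.univ) => (hp₀ S hS).1 (s i)
    rcases hcover s with h | h <;> by_cases hz : Z s <;> by_cases h' : F₀ s <;>
      by_cases h'' : F₁ s <;> simp_all
  have hswap : ∑ S ∈ A₀, probEvent (p S) (fun s => F₁ s ∧ Z s) =
      ∑ S ∈ A₁, probEvent (p S) (fun s => F₁ s ∧ Z s) := by
    simp only [probEvent]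
    rw [Finset.sum_comm, Finset.sum_comm (s := A₁)]
    refine Finset.sum_congr rfl fun s _ => ?_
    by_cases h : F₁ s ∧ Z s
    · simpa [h] using hZ s h.2
    · simp [h]
  have hne₁ : A₁.Nonempty := by
    rw [← Finset.card_pos, ← hcard]; exact hne.card_pos
  have b₀ : ∑ S ∈ A₀, probEvent (p S) F₀ < A₀.card * ε := by
    rw [← nsmul_eq_mul, ← Finset.sum_const]
    exact Finset.sum_lt_sum_of_nonempty hne h₀
  have b₁ : ∑ S ∈ A₁, probEvent (p S) (fun s => F₁ s ∧ Z s) < A₀.card * ε := by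
    rw [hcard, ← nsmul_eq_mul, ← Finset.sum_const]
    exact Finset.sum_lt_sum_of_nonempty hne₁ fun S hS =>
      (probEvent_mono (hp₁ S hS).1 fun s h => h.1).trans_lt (h₁ S hS)
  have b₂ := Finset.sum_le_card_nsmul _ _ _ htail
  have b₃ := Finset.sum_le_sum hone
  simp only [Finset.sum_add_distrib, Finset.sum_const, nsmul_eq_mul, mul_one] at b₂ b₃
  rw [hswap] at b₃
  linarith

/-- A union bound for the event that some `R b` is hit at least `M` times by `n` samples. -/
lemma probEvent_exists_hits_le {Y B : Type*} [Fintype Y] [Fintype B] {p : Y → ℝ}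
    (hp : IsDist p) (R : B → Y → Prop) [∀ b, DecidablePred (R b)] {w : ℝ}
    (hw : ∀ b, ∑ y, (if R b y then p y else 0) = w) (n M : ℕ) :
    probEvent p (fun s : Fin n → Y =>
      ∃ b, M ≤ (Finset.univ.filter fun i => R b (s i)).card) ≤
      Fintype.card B * (n * w) ^ M := by
  classical
  have hnn : ∀ (b : B) (I : Finset (Fin n)) (s : Fin n → Y),
      0 ≤ ∏ i, (if i ∈ I then if R b (s i) then p (s i) else 0 else p (s i)) := by
    intro b I s
    refine Finset.prod_nonneg fun i _ => ?_
    have := hp.1 (s i)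
    split_ifs <;> simp [this]
  have hpt : ∀ s : Fin n → Y,
      (if ∃ b, M ≤ (Finset.univ.filter fun i => R b (s i)).card then ∏ i, p (s i) else 0) ≤
      ∑ b, ∑ I ∈ Finset.powersetCard M (Finset.univ : Finset (Fin n)),
        ∏ i, (if i ∈ I then if R b (s i) then p (s i) else 0 else p (s i)) := by
    intro s
    split_ifs with h
    · obtain ⟨b, hb⟩ := h
      obtain ⟨I, hI, hIc⟩ := Finset.exists_subset_card_eq hb
      have hmem : I ∈ Finset.powersetCard M (Finset.univ : Finset (Fin n)) := by
        simp [Finset.mem_powersetCard, hIc]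
      refine le_trans (le_of_eq ?_) ((Finset.single_le_sum (fun I _ => hnn b I s) hmem).trans
        (Finset.single_le_sum (fun b _ => Finset.sum_nonneg fun I _ => hnn b I s)
          (Finset.mem_univ b)))
      refine Finset.prod_congr rfl fun i _ => ?_
      by_cases hi : i ∈ I
      · have := hI hi
        simp only [Finset.mem_filter] at this
        simp [this.2]
      · simp [hi]
    · exact Finset.sum_nonneg fun b _ => Finset.sum_nonneg fun I _ => hnn b I s
  have hval : ∀ b, ∀ I ∈ Finset.powersetCard M (Finset.univ : Finset (Fin n)),
      ∑ s : Fin n → Y,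
        ∏ i, (if i ∈ I then if R b (s i) then p (s i) else 0 else p (s i)) = w ^ M := by
    intro b I hI
    have := Finset.prod_univ_sum (fun _ : Fin n => (Finset.univ : Finset Y))
      (fun i y => if i ∈ I then if R b y then p y else 0 else p y)
    rw [Fintype.piFinset_univ] at this
    rw [← this]
    have hfac : ∀ i : Fin n, ∑ y, (if i ∈ I then if R b y then p y else 0 else p y) =
        if i ∈ I then w else 1 := by
      intro i
      by_cases hi : i ∈ I
      · simpa [hi] using hw b
      · simpa [hi] using hp.2
    simp only [hfac, Finset.prod_ite_mem, Finset.univ_inter, Finset.prod_const,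
      (Finset.mem_powersetCard.1 hI).2]
  unfold probEvent
  calc _ ≤ _ := Finset.sum_le_sum fun s _ => by
        refine le_trans (le_of_eq ?_) (hpt s)
        congr
    _ = ∑ b : B, ∑ I ∈ Finset.powersetCard M (Finset.univ : Finset (Fin n)), w ^ M := by
      rw [Finset.sum_comm]
      refine Finset.sum_congr rfl fun b _ => ?_
      rw [Finset.sum_comm]
      exact Finset.sum_congr rfl (hval b)
    _ = Fintype.card B * (n.choose M * w ^ M) := by simp
    _ ≤ Fintype.card B * (n * w) ^ M := by
      rcases isEmpty_or_nonempty B with hB | ⟨⟨b⟩⟩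
      · simp
      have hw0 : 0 ≤ w := by
        rw [← hw b]
        exact Finset.sum_nonneg fun y _ => by have := hp.1 y; split_ifs <;> simp [this]
      rw [mul_pow]
      gcongr
      exact_mod_cast Nat.choose_le_pow n M

/-- A lower bound over an alphabet `Y` transfers to any alphabet at least as large. -/
lemma exists_isDist_of_embedding {X Y : Type*} [Fintype X] [Fintype Y] {α : ℝ} (hα : α ≠ 0)
    (e : Y ↪ X) {n : ℕ} {δ : ℝ} (f : (Fin n → X) → ℝ) {p : Y → ℝ} (hp : IsDist p) :
    ∃ p' : X → ℝ, IsDist p' ∧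
      probEvent p' (fun s => δ < |renyiEntropy α p' - f s|) =
        probEvent p (fun s => δ < |renyiEntropy α p - f (e ∘ s)|) := by
  classical
  set p' : X → ℝ := Function.extend e p fun _ => 0
  have hap : ∀ y, p' (e y) = p y := e.injective.extend_apply p _
  have hout : ∀ x, x ∉ Set.range e → p' x = 0 := fun x hx =>
    Function.extend_apply' p _ x (by simpa using hx)
  have hH : renyiEntropy α p' = renyiEntropy α p := by
    unfold renyiEntropy
    rw [Fintype.sum_of_injective e e.injective (fun y => p y ^ α) (fun x => p' x ^ α)
      (fun x hx => by simp [hout x hx, hα]) (fun y => by simp [hap])]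
  refine ⟨p', ⟨fun x => ?_, ?_⟩, ?_⟩
  · by_cases hx : x ∈ Set.range e
    · obtain ⟨y, rfl⟩ := hx
      rw [hap]; exact hp.1 y
    · rw [hout x hx]
  · rw [← hp.2]
    exact (Fintype.sum_of_injective e e.injective p p' hout fun y => (hap y).symm).symm
  · rw [hH]
    refine (Fintype.sum_of_injective (fun s : Fin n → Y => e ∘ s)
      e.injective.comp_left _ _ (fun s hs => ?_) fun s => ?_).symm
    · obtain ⟨i, hi⟩ : ∃ i, s i ∉ Set.range e := by
        by_contra! h
        choose u hu using h
        exact hs ⟨u, funext hu⟩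
      have : ∏ i, p' (s i) = 0 := Finset.prod_eq_zero (Finset.mem_univ i) (hout _ hi)
      simp [this]
    · simp [hap]

/-- The vector on an alphabet with one special symbol and `m` blocks indexed by the even binary
vectors: the special symbol gets `r`, and block `b` gets a translate of the shifted weight,
scaled by `q`. -/
def blockDist {M m : ℕ} (q t r : ℝ) (S : Fin m → Fin M → ZMod 2) :
    Option (Fin m × EvenVec M) → ℝ
  | none => r
  | some (b, T) => q * shiftedWeight t (S b + T.1)

lemma sum_comp_blockDist {M m : ℕ} {q t r : ℝ} {c : ZMod 2} {S : Fin m → Fin M → ZMod 2}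
    (hS : ∀ b, S b ∈ parityClass M c) (φ : ℝ → ℝ) :
    ∑ y, φ (blockDist q t r S y) =
      φ r + m * ∑ U ∈ parityClass M c, φ (q * shiftedWeight t U) := by
  rw [Fintype.sum_option, Fintype.sum_prod_type]
  simp only [blockDist]
  rw [Finset.sum_congr rfl fun b _ =>
    sum_evenVec_add (hS b) fun U => φ (q * shiftedWeight t U)]
  simp

lemma isDist_blockDist {M m : ℕ} {q t r : ℝ} {c : ZMod 2} {S : Fin m → Fin M → ZMod 2}
    (hS : ∀ b, S b ∈ parityClass M c) (hq : 0 ≤ q) (ht : 0 ≤ t) (hr : 0 ≤ r)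
    (hsum : r + m * (q * ∑ U ∈ parityClass M c, shiftedWeight t U) = 1) :
    IsDist (blockDist q t r S) := by
  constructor
  · rintro (_ | ⟨b, T⟩)
    · exact hr
    · exact mul_nonneg hq (shiftedWeight_nonneg ht _)
  · have := sum_comp_blockDist (q := q) (t := t) (r := r) hS id
    simp only [id, ← Finset.mul_sum] at this
    rw [this, hsum]

lemma sum_blockDist_block {M m : ℕ} {q t r : ℝ} {c : ZMod 2} {S : Fin m → Fin M → ZMod 2}
    (hS : ∀ b, S b ∈ parityClass M c) (b : Fin m) :
    ∑ y, (if y.map Prod.fst = some b then blockDist q t r S y else 0) =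
      q * ∑ U ∈ parityClass M c, shiftedWeight t U := by
  rw [Fintype.sum_option, Fintype.sum_prod_type, Finset.sum_eq_single b]
  · simp only [Option.map_none, Option.map_some, blockDist, if_true]
    rw [sum_evenVec_add (hS b) fun U => q * shiftedWeight t U, Finset.mul_sum]
    simp
  · intro b' _ hb'
    simp [hb']
  · simp

/-- The even and the odd mixtures of block distributions give the same likelihood to every
sample that hits each block fewer than `M` times. -/
lemma sum_prod_blockDist_eq {M m n : ℕ} (hM : 0 < M) (q t r : ℝ)
    (s : Fin n → Option (Fin m × EvenVec M))
    (hs : ∀ b, (Finset.univ.filter fun i => (s i).map Prod.fst = some b).card < M) :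
    ∑ S ∈ Fintype.piFinset fun _ : Fin m => parityClass M 0, ∏ i, blockDist q t r S (s i) =
      ∑ S ∈ Fintype.piFinset fun _ : Fin m => parityClass M 1,
        ∏ i, blockDist q t r S (s i) := by
  have hfac : ∀ S : Fin m → Fin M → ZMod 2, ∏ i, blockDist q t r S (s i) =
      (∏ i : {i // (s i).map Prod.fst = none}, r) *
        ∏ b, ∏ i : {i // (s i).map Prod.fst = some b},
          blockDist q t r (fun _ : Fin m => S b) (s i) := by
    intro S
    rw [← Fintype.prod_fiberwise fun i => (s i).map Prod.fst, Fintype.prod_option]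
    congr 1
    · refine Finset.prod_congr rfl fun i _ => ?_
      rw [Option.map_eq_none_iff.1 i.2]
      rfl
    · refine Finset.prod_congr rfl fun b _ => Finset.prod_congr rfl fun i _ => ?_
      obtain ⟨y, hy, rfl⟩ := Option.map_eq_some_iff.1 i.2
      rw [hy]
      rfl
  have hblock : ∀ b : Fin m,
      ∑ σ ∈ parityClass M 0, ∏ i : {i // (s i).map Prod.fst = some b},
          blockDist q t r (fun _ : Fin m => σ) (s i) =
        ∑ σ ∈ parityClass M 1, ∏ i : {i // (s i).map Prod.fst = some b},
          blockDist q t r (fun _ : Fin m => σ) (s i) := by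
    intro b
    have hadd : ∀ y : Option (Fin m × EvenVec M), ∃ h : Fin M → ZMod 2 → ℝ,
        ∀ σ, blockDist q t r (fun _ : Fin m => σ) y = ∑ i, h i (σ i) := by
      rintro (_ | ⟨b, T⟩)
      · refine ⟨fun _ _ => r / M, fun σ => ?_⟩
        have : (M : ℝ) ≠ 0 := by positivity
        simp only [blockDist, Finset.sum_const, Finset.card_univ, Fintype.card_fin,
          nsmul_eq_mul]
        field_simp
      · refine ⟨fun i z => q * (t / M + ((z + T.1 i).val : ℝ)), fun σ => ?_⟩
        simp [blockDist, shiftedWeight_eq_sum hM, Finset.mul_sum]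
    choose h hh using hadd
    simp only [hh]
    refine sum_parityClass_prod_eq ?_ _
    rw [Fintype.card_subtype]
    exact hs b
  simp only [hfac, ← Finset.mul_sum]
  congr 1
  have hprod : ∀ c : ZMod 2, ∑ S ∈ Fintype.piFinset fun _ : Fin m => parityClass M c,
      ∏ b, ∏ i : {i // (s i).map Prod.fst = some b},
        blockDist q t r (fun _ : Fin m => S b) (s i) =
      ∏ b, ∑ σ ∈ parityClass M c, ∏ i : {i // (s i).map Prod.fst = some b},
        blockDist q t r (fun _ : Fin m => σ) (s i) := fun c =>
    (Finset.prod_univ_sum (fun _ : Fin m => parityClass M c) fun b σ =>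
      ∏ i : {i // (s i).map Prod.fst = some b},
        blockDist q t r (fun _ : Fin m => σ) (s i)).symm
  rw [hprod, hprod]
  exact Finset.prod_congr rfl fun b _ => hblock b

lemma renyiEntropy_blockDist {M m : ℕ} {α t r : ℝ} (hα0 : 0 < α) (hm : 0 < m) (ht : 0 ≤ t)
    {c : ZMod 2} {S : Fin m → Fin M → ZMod 2} (hS : ∀ b, S b ∈ parityClass M c) :
    renyiEntropy α (blockDist ((m : ℝ) ^ (-(1 / α))) t r S) =
      1 / (1 - α) * Real.log (r ^ α + ∑ U ∈ parityClass M c, shiftedWeight t U ^ α) := by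
  have hm' : (0 : ℝ) < m := by positivity
  unfold renyiEntropy
  rw [sum_comp_blockDist hS fun x => x ^ α, Finset.mul_sum]
  congr 3
  refine Finset.sum_congr rfl fun U _ => ?_
  rw [mul_rpow (by positivity) (shiftedWeight_nonneg ht U), ← rpow_mul hm'.le, ← mul_assoc]
  have : -(1 / α) * α = -1 := by field_simp
  rw [this, rpow_neg_one, mul_inv_cancel₀ hm'.ne', one_mul]

lemma abs_log_sub_log_ge {x y K : ℝ} (hx : 0 < x) (hy : 0 < y) (hxK : x ≤ K) (hyK : y ≤ K) :
    |x - y| / K ≤ |Real.log x - Real.log y| := by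
  wlog hxy : y ≤ x generalizing x y
  · rw [abs_sub_comm, abs_sub_comm (Real.log x)]
    exact this hy hx hyK hxK (le_of_not_ge hxy)
  have h := Real.add_one_le_exp (Real.log y - Real.log x)
  rw [Real.exp_sub, Real.exp_log hx, Real.exp_log hy] at h
  calc |x - y| / K = (x - y) / K := by rw [abs_of_nonneg (by linarith)]
    _ ≤ (x - y) / x := by gcongr
    _ = 1 - y / x := by field_simp
    _ ≤ Real.log x - Real.log y := by linarith
    _ ≤ _ := le_abs_self _

/-- The lower bound over an alphabet consisting of one special symbol and `m` blocks. -/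
lemma exists_isDist_block_probEvent_ge {M m n : ℕ} (hM : 2 ≤ M) (hm : 0 < m)
    {α ε t W A₀ A₁ δ : ℝ} (hα0 : 0 < α) (hα1 : α < 1) (ht : 0 ≤ t)
    (hW : ∑ U ∈ parityClass M 0, shiftedWeight t U = W)
    (hA₀ : ∑ U ∈ parityClass M 0, shiftedWeight t U ^ α = A₀)
    (hA₁ : ∑ U ∈ parityClass M 1, shiftedWeight t U ^ α = A₁)
    (hδ : 2 * δ * (1 - α) * (1 + A₀ + A₁) < |A₀ - A₁|)
    (hWm : m * ((m : ℝ) ^ (-(1 / α)) * W) < 1)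
    (htail : m * (n * ((m : ℝ) ^ (-(1 / α)) * W)) ^ M ≤ 1 - 2 * ε)
    (f : (Fin n → Option (Fin m × EvenVec M)) → ℝ) :
    ∃ p : Option (Fin m × EvenVec M) → ℝ, IsDist p ∧
      ε ≤ probEvent p (fun s => δ < |renyiEntropy α p - f s|) := by
  set q : ℝ := (m : ℝ) ^ (-(1 / α)) with hq
  have hq0 : 0 ≤ q := by positivity
  have hW₁ : ∑ U ∈ parityClass M 1, shiftedWeight t U = W := by
    rw [← hW, sum_shiftedWeight_eq hM]
  have hW0 : 0 ≤ W := hW ▸ Finset.sum_nonneg fun U _ => shiftedWeight_nonneg ht U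
  have hA₀0 : 0 ≤ A₀ :=
    hA₀ ▸ Finset.sum_nonneg fun U _ => rpow_nonneg (shiftedWeight_nonneg ht U) _
  have hA₁0 : 0 ≤ A₁ :=
    hA₁ ▸ Finset.sum_nonneg fun U _ => rpow_nonneg (shiftedWeight_nonneg ht U) _
  set r : ℝ := 1 - m * (q * W)
  have hr : 0 < r := by simp only [r]; linarith
  have hr1 : r ≤ 1 := by
    have : 0 ≤ m * (q * W) := by positivity
    simp only [r]; linarith
  have hrα : 0 < r ^ α := by positivity
  have hrα1 : r ^ α ≤ 1 := rpow_le_one hr.le hr1 hα0.le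
  have hdist₀ : ∀ S ∈ Fintype.piFinset fun _ : Fin m => parityClass M 0,
      IsDist (blockDist q t r S) := fun S hS =>
    isDist_blockDist (Fintype.mem_piFinset.1 hS) hq0 ht hr.le (by rw [hW]; simp [r])
  have hdist₁ : ∀ S ∈ Fintype.piFinset fun _ : Fin m => parityClass M 1,
      IsDist (blockDist q t r S) := fun S hS =>
    isDist_blockDist (Fintype.mem_piFinset.1 hS) hq0 ht hr.le (by rw [hW₁]; simp [r])
  have hsep : 2 * δ < |1 / (1 - α) * Real.log (r ^ α + A₀) -
      1 / (1 - α) * Real.log (r ^ α + A₁)| := by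
    have h1α : 0 < 1 - α := by linarith
    have hlog := abs_log_sub_log_ge (x := r ^ α + A₀) (y := r ^ α + A₁) (K := 1 + A₀ + A₁)
      (by positivity) (by positivity) (by linarith) (by linarith)
    rw [add_sub_add_left_eq_sub] at hlog
    rw [← mul_sub, abs_mul, abs_of_pos (by positivity : 0 < 1 / (1 - α))]
    refine lt_of_lt_of_le ?_ (mul_le_mul_of_nonneg_left hlog (by positivity))
    rw [one_div_mul_eq_div, div_div, lt_div_iff₀ (by positivity)]
    linarith
  obtain ⟨S, hS, hfail⟩ := exists_probEvent_ge_of_mixtures (n := n) (α := α) (ε := ε)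
    (A₀ := Fintype.piFinset fun _ : Fin m => parityClass M 0)
    (A₁ := Fintype.piFinset fun _ : Fin m => parityClass M 1)
    (by simp [card_parityClass_eq (by omega : 0 < M)])
    ⟨fun _ => 0, Fintype.mem_piFinset.2 fun _ => zero_mem_parityClass M⟩
    hdist₀ hdist₁
    (fun S hS => by
      rw [hq, renyiEntropy_blockDist hα0 hm ht (Fintype.mem_piFinset.1 hS), hA₀])
    (fun S hS => by
      rw [hq, renyiEntropy_blockDist hα0 hm ht (Fintype.mem_piFinset.1 hS), hA₁])
    hsep
    (fun s => ∀ b, (Finset.univ.filter fun i => (s i).map Prod.fst = some b).card < M)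
    (fun s hs => sum_prod_blockDist_eq (by omega) q t r s hs)
    (fun S hS => by
      have := probEvent_exists_hits_le (hdist₀ S hS)
        (fun (b : Fin m) (y : Option (Fin m × EvenVec M)) => y.map Prod.fst = some b)
        (sum_blockDist_block (Fintype.mem_piFinset.1 hS)) n M
      rw [hW, Fintype.card_fin] at this
      simpa only [not_forall, not_lt] using this.trans htail) f
  exact ⟨_, hS, hfail⟩

/-- **Lower bound for `0 < α < 1`.**  For every real `0 < α < 1`, every `0 < ε < 1/2` and
every `η > 0`, there exist `δ > 0` and `c > 0` such that for all sufficiently large `k`: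
any estimator using `n ≤ c k^{1/α - η}` samples fails, on some distribution over `k`
symbols, to estimate the order-`α` Rényi entropy to within `δ` with probability at least
`ε`.  Thus `S_α(k)` grows polynomially in `k` with exponent at least `1/α - η` for every
`η > 0`. -/
theorem renyi_lower_bound_lt_one (α : ℝ) (hα0 : 0 < α) (hα1 : α < 1)
    (ε : ℝ) (hε0 : 0 < ε) (hε1 : ε < 1 / 2) :
    ∀ η > (0 : ℝ), ∃ δ > (0 : ℝ), ∃ c > (0 : ℝ), ∃ K : ℕ, ∀ k : ℕ, K ≤ k →
      ∀ n : ℕ, (n : ℝ) ≤ c * (k : ℝ) ^ (1 / α - η) →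
        ∀ f : (Fin n → Fin k) → ℝ,
          ∃ p : Fin k → ℝ, IsDist p ∧
            ε ≤ probEvent p (fun s => δ < |renyiEntropy α p - f s|) := by
  intro η hη
  obtain ⟨M, hM2, hMη⟩ : ∃ M : ℕ, 2 ≤ M ∧ 2 ≤ η * M := by
    obtain ⟨N, hN⟩ := exists_nat_ge (2 / η)
    refine ⟨N + 2, by omega, ?_⟩
    rw [div_le_iff₀ hη] at hN
    push_cast
    nlinarith
  obtain ⟨t, ht, hne⟩ := exists_sum_shiftedWeight_rpow_ne hα0 hα1 M
  obtain ⟨W, hW⟩ : ∃ W, ∑ U ∈ parityClass M 0, shiftedWeight t U = W := ⟨_, rfl⟩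
  obtain ⟨A₀, hA₀⟩ : ∃ A, ∑ U ∈ parityClass M 0, shiftedWeight t U ^ α = A := ⟨_, rfl⟩
  obtain ⟨A₁, hA₁⟩ : ∃ A, ∑ U ∈ parityClass M 1, shiftedWeight t U ^ α = A := ⟨_, rfl⟩
  rw [hA₀, hA₁] at hne
  have hW0 : 0 ≤ W := hW ▸ Finset.sum_nonneg fun U _ => shiftedWeight_nonneg ht U
  have hA₀0 : 0 ≤ A₀ :=
    hA₀ ▸ Finset.sum_nonneg fun U _ => rpow_nonneg (shiftedWeight_nonneg ht U) _
  have hA₁0 : 0 ≤ A₁ :=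
    hA₁ ▸ Finset.sum_nonneg fun U _ => rpow_nonneg (shiftedWeight_nonneg ht U) _
  have h1α : 0 < 1 - α := by linarith
  have hgap : 0 < |A₀ - A₁| := abs_pos.2 (sub_ne_zero.2 hne)
  set d := Fintype.card (EvenVec M) with hd
  have hd0 : 0 < d := Fintype.card_pos_iff.2 ⟨⟨0, by simp⟩⟩
  have hdR : (0 : ℝ) < d := by exact_mod_cast hd0
  set C : ℝ := (2 * d : ℝ) ^ (1 / α) * (W + 1)
  have hC : 0 < C := by positivity
  have hdecay : Tendsto (fun m : ℕ => (m : ℝ) ^ (-(1 / α - 1)) * W) atTop (𝓝 0) := by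
    have hexp : 0 < 1 / α - 1 := by
      rw [sub_pos, lt_div_iff₀ hα0]; linarith
    simpa using ((tendsto_rpow_neg_atTop hexp).comp tendsto_natCast_atTop_atTop).mul_const W
  obtain ⟨N, hN⟩ := eventually_atTop.1 ((hdecay.eventually_lt_const one_pos).and
    ((tendsto_inv_atTop_nhds_zero_nat (𝕜 := ℝ)).eventually_lt_const
      (by linarith : (0 : ℝ) < 1 - 2 * ε)))
  refine ⟨|A₀ - A₁| / (4 * (1 - α) * (1 + A₀ + A₁)), by positivity, C⁻¹, by positivity,
    d * (N + 1) + 2 * d + 1, fun k hk n hn f => ?_⟩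
  set m := (k - 1) / d
  have hmN : N + 1 ≤ m := (Nat.le_div_iff_mul_le hd0).2 (by rw [mul_comm]; omega)
  have hm0 : 0 < m := by omega
  have hmR : (0 : ℝ) < m := by exact_mod_cast hm0
  have hmd : d * m + 1 ≤ k := by
    have := Nat.mul_div_le (k - 1) d
    simp only [m]
    omega
  have hkm : k ≤ 2 * d * m := by
    have h1 := Nat.lt_mul_div_succ (k - 1) hd0
    have h2 : d * ((k - 1) / d + 1) = d * m + d := by simp only [m]; ring
    have h3 : 2 * d * m = d * m + d * m := by ring
    have h4 : 2 * d ≤ k := by omega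
    omega
  have hmk : m ≤ k := by nlinarith
  obtain ⟨e⟩ : Nonempty (Option (Fin m × EvenVec M) ↪ Fin k) := by
    refine Function.Embedding.nonempty_of_card_le ?_
    rw [Fintype.card_option, Fintype.card_prod, Fintype.card_fin, Fintype.card_fin, ← hd,
      mul_comm]
    exact hmd
  obtain ⟨hN1, hN2⟩ := hN m (by omega)
  have hmass : m * ((m : ℝ) ^ (-(1 / α)) * W) < 1 := by
    refine lt_of_eq_of_lt ?_ hN1
    rw [neg_sub, sub_eq_add_neg, rpow_add hmR, rpow_one, mul_assoc]
  have hnq : n * ((m : ℝ) ^ (-(1 / α)) * W) ≤ (m : ℝ) ^ (-η) := by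
    have hkR : (0 : ℝ) < k := by exact_mod_cast (by omega : 0 < k)
    have hk1 : (k : ℝ) ^ (1 / α) ≤ (2 * d : ℝ) ^ (1 / α) * (m : ℝ) ^ (1 / α) := by
      rw [← mul_rpow (by positivity) hmR.le]
      exact rpow_le_rpow hkR.le (by exact_mod_cast hkm) (by positivity)
    have hk2 : (k : ℝ) ^ (-η) ≤ (m : ℝ) ^ (-η) :=
      rpow_le_rpow_of_nonpos hmR (by exact_mod_cast hmk) (by linarith)
    have hmm : (m : ℝ) ^ (1 / α) * (m : ℝ) ^ (-(1 / α)) = 1 := by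
      rw [← rpow_add hmR]; simp
    calc n * ((m : ℝ) ^ (-(1 / α)) * W)
        ≤ (C⁻¹ * (((2 * d : ℝ) ^ (1 / α) * (m : ℝ) ^ (1 / α)) * (m : ℝ) ^ (-η))) *
          ((m : ℝ) ^ (-(1 / α)) * (W + 1)) := by
          gcongr
          · refine hn.trans ?_
            rw [sub_eq_add_neg, rpow_add hkR]
            gcongr
          · linarith
      _ = C⁻¹ * C * ((m : ℝ) ^ (1 / α) * (m : ℝ) ^ (-(1 / α))) * (m : ℝ) ^ (-η) := by
          simp only [C]; ring
      _ = (m : ℝ) ^ (-η) := by rw [hmm, inv_mul_cancel₀ hC.ne']; ring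
  have htail : m * (n * ((m : ℝ) ^ (-(1 / α)) * W)) ^ M ≤ 1 - 2 * ε := by
    have hm1 : (1 : ℝ) ≤ m := by exact_mod_cast hm0
    calc m * (n * ((m : ℝ) ^ (-(1 / α)) * W)) ^ M ≤ m * ((m : ℝ) ^ (-η)) ^ M := by gcongr
      _ = m * (m : ℝ) ^ (-η * M) := by rw [rpow_mul hmR.le, rpow_natCast]
      _ ≤ m * (m : ℝ) ^ (-2 : ℝ) := by
          gcongr
          linarith
      _ = (m : ℝ)⁻¹ := by
          rw [rpow_neg hmR.le, rpow_two]
          field_simp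
      _ ≤ 1 - 2 * ε := hN2.le
  obtain ⟨p, hp, hfail⟩ := exists_isDist_block_probEvent_ge hM2 hm0 (ε := ε)
    (δ := |A₀ - A₁| / (4 * (1 - α) * (1 + A₀ + A₁))) hα0 hα1 ht hW hA₀ hA₁
    (by
      have : 2 * (|A₀ - A₁| / (4 * (1 - α) * (1 + A₀ + A₁))) * (1 - α) * (1 + A₀ + A₁) =
          |A₀ - A₁| / 2 := by
        field_simp
        ring
      rw [this]
      linarith) hmass htail (fun s => f (e ∘ s))
  obtain ⟨p', hp', heq⟩ := exists_isDist_of_embedding hα0.ne' e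
    (δ := |A₀ - A₁| / (4 * (1 - α) * (1 + A₀ + A₁))) f hp
  exact ⟨p', hp', heq ▸ hfail⟩
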